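/- arXiv:2111.12822 — 2 statements merged into one kernel-verified Lean document; each statement's English description precedes it below -/
import Mathlib

section
/- (K_G-type fading: equal shape parameters.) Let f be a mixture gamma density with parameters L, {α_l}, {β_l}, {ζ_l} in which all shape parameters are equal, β_l = m₀ for all l = 1,…,L, and let m be an MMSE-type function with induced quantities I, I_∞, M̂. Then Ī(γ̄) = ∫_0^∞ f(a) I(γ̄ a) da satisfies, as γ̄ → ∞, Ī(γ̄) = I_∞ − ((Σ_{l=1}^L α_l)/m₀) M̂(m₀) · γ̄^{−m₀} + O(γ̄^{−m₀−1}). -/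
open MeasureTheory Real Filter Set

/-- An MMSE-type function is dominated by an exponential on the whole half-line. -/
lemma exists_exp_bound_of_mmse {m : ℝ → ℝ}
    (hm_cont : ContinuousOn m (Set.Ioi 0))
    (hm_lim : Tendsto m (nhdsWithin 0 (Set.Ioi 0)) (nhds 1))
    (hm_decay : ∃ C > 0, ∃ c > 0, ∀ t ≥ 1,
      m t ≤ C * t ^ (-(1 : ℝ) / 2) * Real.exp (-c * t)) :
    ∃ K > 0, ∃ c > 0, ∀ t > 0, m t ≤ K * Real.exp (-c * t) := by
  obtain ⟨C, hC, c, hc, hdec⟩ := hm_decay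
  obtain ⟨δ, hδ, hnear⟩ : ∃ δ > 0, ∀ t, 0 < t → t < δ → m t ≤ 2 := by
    have h := hm_lim.eventually (eventually_le_nhds (show (1 : ℝ) < 2 by norm_num))
    rw [eventually_nhdsWithin_iff, Metric.eventually_nhds_iff] at h
    obtain ⟨δ, hδ, h⟩ := h
    refine ⟨δ, hδ, fun t ht htδ => h ?_ ht⟩
    rwa [Real.dist_eq, sub_zero, abs_of_pos ht]
  obtain ⟨B, hB⟩ := (isCompact_Icc (a := δ) (b := 1)).exists_bound_of_continuousOn
    (hm_cont.mono fun t ht => lt_of_lt_of_le hδ ht.1)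
  have hbdd : ∀ t, 0 < t → t ≤ 1 → m t ≤ 2 + |B| := by
    intro t ht ht1
    rcases lt_or_ge t δ with h | h
    · linarith [hnear t ht h, abs_nonneg B]
    · have := hB t ⟨h, ht1⟩
      linarith [le_abs_self B, (le_abs_self (m t)).trans this]
  have hKpos : 0 < (2 + |B|) * Real.exp c := by positivity
  refine ⟨(2 + |B|) * Real.exp c + C, by positivity, c, hc, fun t ht => ?_⟩
  have hexp := Real.exp_pos (-c * t)
  rcases le_or_gt t 1 with h | h
  · have h1 : 1 ≤ Real.exp c * Real.exp (-c * t) := by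
      rw [← Real.exp_add]
      exact Real.one_le_exp (by nlinarith)
    have h2 : (0 : ℝ) ≤ 2 + |B| := by positivity
    nlinarith [hbdd t ht h, mul_le_mul_of_nonneg_left h1 h2, mul_pos hC hexp]
  · have h1 : t ^ (-(1 : ℝ) / 2) ≤ 1 := Real.rpow_le_one_of_one_le_of_nonpos h.le (by norm_num)
    have h2 : C * t ^ (-(1 : ℝ) / 2) * Real.exp (-c * t) ≤ C * 1 * Real.exp (-c * t) := by
      gcongr
    nlinarith [hdec t h.le, mul_pos hKpos hexp]

lemma integrableOn_rpow_mul_exp_neg {s c : ℝ} (hs : 0 < s) (hc : 0 < c) :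
    IntegrableOn (fun x : ℝ => x ^ (s - 1) * Real.exp (-c * x)) (Set.Ioi 0) := by
  simpa using integrableOn_rpow_mul_exp_neg_mul_rpow (p := 1) (s := s - 1) (b := c)
    (by linarith) one_pos hc

lemma integrableOn_rpow_mul_of_exp_bound {g : ℝ → ℝ} {K c s : ℝ} (hs : 0 < s) (hc : 0 < c)
    (hg : ContinuousOn g (Set.Ioi 0)) (hbound : ∀ t > 0, |g t| ≤ K * Real.exp (-c * t)) :
    IntegrableOn (fun x => x ^ (s - 1) * g x) (Set.Ioi 0) := by
  refine Integrable.mono' ((integrableOn_rpow_mul_exp_neg hs hc).const_mul K) ?_ ?_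
  · refine ContinuousOn.aestronglyMeasurable ?_ measurableSet_Ioi
    exact (continuousOn_id.rpow_const fun x hx => Or.inl (ne_of_gt hx)).mul hg
  · filter_upwards [ae_restrict_mem measurableSet_Ioi] with x hx
    have hx' : 0 < x := hx
    have hp : 0 < x ^ (s - 1) := Real.rpow_pos_of_pos hx' _
    rw [Real.norm_eq_abs, abs_mul, abs_of_pos hp]
    nlinarith [mul_le_mul_of_nonneg_left (hbound x hx') hp.le]

section Tail

variable {m : ℝ → ℝ} {K c : ℝ}

lemma integrableOn_of_exp_bound (hc : 0 < c) (hm : ContinuousOn m (Set.Ioi 0))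
    (hbound : ∀ t > 0, |m t| ≤ K * Real.exp (-c * t)) : IntegrableOn m (Set.Ioi 0) := by
  simpa using integrableOn_rpow_mul_of_exp_bound one_pos hc hm hbound

lemma abs_tail_le (hc : 0 < c)
    (hbound : ∀ t > 0, |m t| ≤ K * Real.exp (-c * t)) {x : ℝ} (hx : 0 ≤ x) :
    |∫ t in Set.Ioi x, m t| ≤ K / c * Real.exp (-c * x) := by
  have h : ‖∫ t in Set.Ioi x, m t‖ ≤ ∫ t in Set.Ioi x, K * Real.exp (-c * t) := by
    refine norm_integral_le_of_norm_le ((exp_neg_integrableOn_Ioi x hc).const_mul K) ?_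
    filter_upwards [ae_restrict_mem measurableSet_Ioi] with t ht
    exact hbound t (lt_of_le_of_lt hx ht)
  rw [integral_const_mul, integral_exp_mul_Ioi (neg_lt_zero.mpr hc)] at h
  refine h.trans (le_of_eq ?_)
  field_simp

lemma integral_Ioi_eq_sub (hint : IntegrableOn m (Set.Ioi 0)) {x : ℝ} (hx : 0 ≤ x) :
    ∫ t in Set.Ioi x, m t = (∫ t in Set.Ioi 0, m t) - ∫ t in Set.Ioc 0 x, m t := by
  rw [← Set.Ioc_union_Ioi_eq_Ioi hx, setIntegral_union (Set.Ioc_disjoint_Ioi le_rfl)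
    measurableSet_Ioi (hint.mono_set Set.Ioc_subset_Ioi_self)
    (hint.mono_set (Set.Ioi_subset_Ioi hx))]
  ring

lemma hasDerivAt_tail (hm : ContinuousOn m (Set.Ioi 0))
    (hint : IntegrableOn m (Set.Ioi 0)) {x : ℝ} (hx : 0 < x) :
    HasDerivAt (fun y => ∫ t in Set.Ioi y, m t) (-m x) x := by
  have h := intervalIntegral.integral_hasDerivAt_right
    ((intervalIntegrable_iff_integrableOn_Ioc_of_le hx.le).mpr
      (hint.mono_set Set.Ioc_subset_Ioi_self))
    (hm.stronglyMeasurableAtFilter isOpen_Ioi x hx) (hm.continuousAt (Ioi_mem_nhds hx))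
  refine (h.const_sub (∫ t in Set.Ioi 0, m t)).congr_of_eventuallyEq ?_
  filter_upwards [Ioi_mem_nhds hx] with y hy
  rw [integral_Ioi_eq_sub hint (le_of_lt hy), intervalIntegral.integral_of_le (le_of_lt hy)]

lemma integrableOn_rpow_mul_tail {s : ℝ} (hs : 0 < s) (hc : 0 < c)
    (hm : ContinuousOn m (Set.Ioi 0)) (hbound : ∀ t > 0, |m t| ≤ K * Real.exp (-c * t)) :
    IntegrableOn (fun x => x ^ (s - 1) * ∫ t in Set.Ioi x, m t) (Set.Ioi 0) :=
  integrableOn_rpow_mul_of_exp_bound hs hc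
    (fun _ hx => (hasDerivAt_tail hm
      (integrableOn_of_exp_bound hc hm hbound) hx).continuousAt.continuousWithinAt)
    (fun _ ht => abs_tail_le hc hbound (le_of_lt ht))

lemma integral_rpow_mul_tail {s : ℝ} (hs : 0 < s) (hc : 0 < c)
    (hm : ContinuousOn m (Set.Ioi 0)) (hbound : ∀ t > 0, |m t| ≤ K * Real.exp (-c * t)) :
    ∫ x in Set.Ioi 0, x ^ (s - 1) * (∫ t in Set.Ioi x, m t)
      = (∫ t in Set.Ioi 0, t ^ s * m t) / s := by
  have hint := integrableOn_of_exp_bound hc hm hbound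
  have hi1 := integrableOn_rpow_mul_tail hs hc hm hbound
  have hi2 : IntegrableOn (fun x => x ^ s * m x) (Set.Ioi 0) := by
    simpa using integrableOn_rpow_mul_of_exp_bound (s := s + 1) (by linarith) hc hm hbound
  have habs : ∀ x, 0 ≤ x → |x ^ s / s * ∫ t in Set.Ioi x, m t|
      ≤ (K / c / s) * (x ^ s * Real.exp (-c * x)) := by
    intro x hx
    have hp : 0 ≤ x ^ s / s := div_nonneg (Real.rpow_nonneg hx _) hs.le
    rw [abs_mul, abs_of_nonneg hp]
    calc x ^ s / s * |∫ t in Set.Ioi x, m t|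
        ≤ x ^ s / s * (K / c * Real.exp (-c * x)) :=
          mul_le_mul_of_nonneg_left (abs_tail_le hc hbound hx) hp
      _ = _ := by ring
  have h0 : (0 : ℝ) ^ s / s * ∫ t in Set.Ioi 0, m t = 0 := by
    simp [Real.zero_rpow hs.ne']
  have h := integral_Ioi_of_hasDerivAt_of_tendsto
    (f := fun x : ℝ => x ^ s / s * ∫ t in Set.Ioi x, m t)
    (f' := fun x => x ^ (s - 1) * (∫ t in Set.Ioi x, m t) - (x ^ s * m x) / s)
    (a := 0) (m := 0) ?_ ?_ (hi1.sub (hi2.div_const s)) ?_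
  · rw [integral_sub hi1 (hi2.div_const s), integral_div, h0] at h
    linarith
  · rw [ContinuousWithinAt, h0]
    refine squeeze_zero_norm' (a := fun x => (K / c / s) * (x ^ s * Real.exp (-c * x))) ?_ ?_
    · filter_upwards [self_mem_nhdsWithin] with x hx using habs x hx
    · have hcont : ContinuousAt (fun x : ℝ => (K / c / s) * (x ^ s * Real.exp (-c * x))) 0 :=
        continuousAt_const.mul ((Real.continuousAt_rpow_const 0 s (Or.inr hs.le)).mul
          (by fun_prop))
      simpa [ContinuousAt, Real.zero_rpow hs.ne'] using hcont.tendsto.mono_left nhdsWithin_le_nhds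
  · intro x hx
    have hx' : 0 < x := hx
    have h1 := ((Real.hasDerivAt_rpow_const (p := s) (Or.inl hx'.ne')).div_const s).mul
      (hasDerivAt_tail hm hint hx')
    refine h1.congr_deriv ?_
    field_simp
    ring
  · refine squeeze_zero_norm' (a := fun x => (K / c / s) * (x ^ s * Real.exp (-c * x))) ?_ ?_
    · filter_upwards [eventually_ge_atTop 0] with x hx using habs x hx
    · simpa using (tendsto_rpow_mul_exp_neg_mul_atTop_nhds_zero s c hc).const_mul (K / c / s)

lemma rpow_mul_comp_mul_eq {g : ℝ → ℝ} {s γ a : ℝ} (hγ : 0 < γ) (ha : 0 < a) :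
    a ^ (s - 1) * g (γ * a) = γ ^ (1 - s) * ((γ * a) ^ (s - 1) * g (γ * a)) := by
  rw [Real.mul_rpow hγ.le ha.le, show 1 - s = -(s - 1) by ring, Real.rpow_neg hγ.le]
  have := (Real.rpow_pos_of_pos hγ (s - 1)).ne'
  field_simp

lemma integrableOn_rpow_mul_tail_comp_mul {s γ : ℝ} (hs : 0 < s) (hγ : 0 < γ) (hc : 0 < c)
    (hm : ContinuousOn m (Set.Ioi 0)) (hbound : ∀ t > 0, |m t| ≤ K * Real.exp (-c * t)) :
    IntegrableOn (fun a => a ^ (s - 1) * ∫ t in Set.Ioi (γ * a), m t) (Set.Ioi 0) := by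
  have h := (integrableOn_Ioi_comp_mul_left_iff
    (fun x => x ^ (s - 1) * ∫ t in Set.Ioi x, m t) 0 hγ).mpr
      (by simpa using integrableOn_rpow_mul_tail hs hc hm hbound)
  refine IntegrableOn.congr_fun (h.const_mul (γ ^ (1 - s))) (fun a ha => ?_) measurableSet_Ioi
  exact (rpow_mul_comp_mul_eq (g := fun x => ∫ t in Set.Ioi x, m t) hγ ha).symm

lemma integral_rpow_mul_tail_comp_mul {s γ : ℝ} (hs : 0 < s) (hγ : 0 < γ) (hc : 0 < c)
    (hm : ContinuousOn m (Set.Ioi 0)) (hbound : ∀ t > 0, |m t| ≤ K * Real.exp (-c * t)) :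
    ∫ a in Set.Ioi 0, a ^ (s - 1) * (∫ t in Set.Ioi (γ * a), m t)
      = γ ^ (-s) * ((∫ t in Set.Ioi 0, t ^ s * m t) / s) := by
  rw [setIntegral_congr_fun measurableSet_Ioi (fun a ha =>
    rpow_mul_comp_mul_eq (g := fun x => ∫ t in Set.Ioi x, m t) (s := s) hγ ha),
    integral_const_mul, integral_comp_mul_left_Ioi
      (fun x => x ^ (s - 1) * ∫ t in Set.Ioi x, m t) 0 hγ, mul_zero,
    integral_rpow_mul_tail hs hc hm hbound, smul_eq_mul, ← mul_assoc]
  congr 1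
  rw [show (1 : ℝ) - s = -s + 1 by ring, Real.rpow_add_one hγ.ne']
  field_simp

end Tail

/-- A gamma mixture with a common shape parameter differs from its leading power by at most
the next power. -/
lemma abs_gamma_mixture_sub_le {L : ℕ} {α ζ : ℕ → ℝ} (hα : ∀ l < L, 0 < α l)
    (hζ : ∀ l < L, 0 < ζ l) {s a : ℝ} (ha : 0 < a) :
    |(∑ l ∈ Finset.range L, α l * a ^ (s - 1) * Real.exp (-(ζ l) * a))
        - (∑ l ∈ Finset.range L, α l) * a ^ (s - 1)|
      ≤ (∑ l ∈ Finset.range L, α l * ζ l) * a ^ s := by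
  rw [Finset.sum_mul, Finset.sum_mul, ← Finset.sum_sub_distrib]
  refine (Finset.abs_sum_le_sum_abs _ _).trans (Finset.sum_le_sum fun l hl => ?_)
  have hα' := hα l (Finset.mem_range.mp hl)
  have hza : 0 ≤ ζ l * a := (mul_pos (hζ l (Finset.mem_range.mp hl)) ha).le
  have hp : 0 < a ^ (s - 1) := Real.rpow_pos_of_pos ha _
  have hs : a ^ s = a ^ (s - 1) * a := by
    rw [← Real.rpow_add_one ha.ne', sub_add_cancel]
  have he : |Real.exp (-(ζ l) * a) - 1| ≤ ζ l * a := by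
    rw [abs_sub_comm, abs_of_nonneg (sub_nonneg.mpr (Real.exp_le_one_iff.mpr (by linarith)))]
    linarith [Real.add_one_le_exp (-(ζ l) * a)]
  rw [show α l * a ^ (s - 1) * Real.exp (-(ζ l) * a) - α l * a ^ (s - 1)
      = α l * a ^ (s - 1) * (Real.exp (-(ζ l) * a) - 1) by ring, abs_mul,
    abs_of_pos (mul_pos hα' hp), hs]
  calc α l * a ^ (s - 1) * |Real.exp (-(ζ l) * a) - 1|
      ≤ α l * a ^ (s - 1) * (ζ l * a) := mul_le_mul_of_nonneg_left he (mul_pos hα' hp).le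
    _ = _ := by ring

/-- **K_G-type fading: equal shape parameters.** For a mixture gamma density
with all shape parameters equal to `m₀` and an MMSE-type function `m`, the AMI satisfies
`Ī(γ̄) = I_∞ − ((Σ_l α_l)/m₀) M̂(m₀) γ̄^{−m₀} + O(γ̄^{−m₀−1})` as `γ̄ → ∞`. -/
theorem asymptotic_AMI_KG
    (L : ℕ) (hL : 0 < L) (α β ζ : ℕ → ℝ)
    (hα : ∀ l < L, 0 < α l) (hβ : ∀ l < L, 0 < β l) (hζ : ∀ l < L, 0 < ζ l)
    (hmono : ∀ l, l + 1 < L → β l ≤ β (l + 1))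
    (hgap : ∀ l, l + 1 < L → β (l + 1) = β l ∨ β l + 1 ≤ β (l + 1))
    (hnorm : ∑ l ∈ Finset.range L, α l * Real.Gamma (β l) * (ζ l) ^ (-(β l)) = 1)
    (m₀ : ℝ) (hshape : ∀ l < L, β l = m₀)
    (f : ℝ → ℝ)
    (hf : ∀ a > 0, f a = ∑ l ∈ Finset.range L, α l * a ^ (β l - 1) * Real.exp (-(ζ l) * a))
    (m : ℝ → ℝ)
    (hm_cont : ContinuousOn m (Set.Ioi 0))
    (hm_pos : ∀ t > 0, 0 < m t)
    (hm_lim : Tendsto m (nhdsWithin 0 (Set.Ioi 0)) (nhds 1))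
    (hm_decay : ∃ C > 0, ∃ c > 0, ∀ t ≥ 1, m t ≤ C * t ^ (-(1 : ℝ) / 2) * Real.exp (-c * t))
    (I : ℝ → ℝ) (hI : ∀ γ ≥ 0, I γ = ∫ t in Set.Ioc 0 γ, m t)
    (Iinf : ℝ) (hIinf : Iinf = ∫ t in Set.Ioi 0, m t)
    (Mhat : ℝ → ℝ) (hMhat : ∀ x > 0, Mhat x = ∫ t in Set.Ioi 0, t ^ x * m t)
    (Ibar : ℝ → ℝ) (hIbar : ∀ γ > 0, Ibar γ = ∫ a in Set.Ioi 0, f a * I (γ * a)) :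
    ∃ C' > 0, ∃ γ0 > 0, ∀ γ ≥ γ0,
      |Ibar γ - Iinf + ((∑ l ∈ Finset.range L, α l) / m₀) * Mhat m₀ * γ ^ (-m₀)|
        ≤ C' * γ ^ (-m₀ - 1) := by
  have hm₀ : 0 < m₀ := hshape 0 hL ▸ hβ 0 hL
  obtain ⟨K, -, c, hc, hle⟩ := exists_exp_bound_of_mmse hm_cont hm_lim hm_decay
  have hbound : ∀ t > 0, |m t| ≤ K * Real.exp (-c * t) := fun t ht => by
    rw [abs_of_pos (hm_pos t ht)]
    exact hle t ht
  have hint := integrableOn_of_exp_bound hc hm_cont hbound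
  set A := ∑ l ∈ Finset.range L, α l
  set B := ∑ l ∈ Finset.range L, α l * ζ l
  have hB0 : 0 ≤ B := Finset.sum_nonneg fun l hl =>
    (mul_pos (hα l (Finset.mem_range.mp hl)) (hζ l (Finset.mem_range.mp hl))).le
  have hf' : ∀ a > 0, f a
      = ∑ l ∈ Finset.range L, α l * a ^ (m₀ - 1) * Real.exp (-(ζ l) * a) := fun a ha => by
    rw [hf a ha]
    exact Finset.sum_congr rfl fun l hl => by rw [hshape l (Finset.mem_range.mp hl)]
  have hterm : ∀ l ∈ Finset.range L,
      IntegrableOn (fun a : ℝ => α l * a ^ (m₀ - 1) * Real.exp (-(ζ l) * a)) (Set.Ioi 0) :=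
    fun l hl => by
      simp only [mul_assoc]
      exact (integrableOn_rpow_mul_exp_neg hm₀ (hζ l (Finset.mem_range.mp hl))).const_mul (α l)
  have hfint : IntegrableOn f (Set.Ioi 0) :=
    IntegrableOn.congr_fun (integrable_finsetSum _ hterm) (fun a ha => (hf' a ha).symm)
      measurableSet_Ioi
  have hfone : ∫ a in Set.Ioi 0, f a = 1 := by
    rw [setIntegral_congr_fun measurableSet_Ioi hf', integral_finsetSum _ hterm]
    refine Eq.trans ?_ hnorm
    refine Finset.sum_congr rfl fun l hl => ?_
    have hl' := Finset.mem_range.mp hl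
    simp_rw [mul_assoc, neg_mul]
    rw [integral_const_mul, integral_rpow_mul_exp_neg_mul_Ioi hm₀ (hζ l hl'), hshape l hl',
      one_div, Real.inv_rpow (hζ l hl').le, Real.rpow_neg (hζ l hl').le]
    ring
  set D := Mhat (m₀ + 1) / (m₀ + 1)
  have hD0 : 0 ≤ D := by
    refine div_nonneg ?_ (by linarith)
    rw [hMhat _ (by linarith)]
    exact setIntegral_nonneg measurableSet_Ioi fun t ht =>
      mul_nonneg (Real.rpow_nonneg (le_of_lt ht) _) (hm_pos t ht).le
  refine ⟨B * D + 1, by positivity, 1, one_pos, fun γ hγ => ?_⟩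
  have hγ0 : 0 < γ := lt_of_lt_of_le one_pos hγ
  set R : ℝ → ℝ := fun a => ∫ t in Set.Ioi (γ * a), m t with hR
  have hR0 : ∀ a, 0 < a → 0 ≤ R a := fun a ha =>
    setIntegral_nonneg measurableSet_Ioi fun t ht =>
      (hm_pos t (lt_trans (mul_pos hγ0 ha) ht)).le
  have hi1 : IntegrableOn (fun a => a ^ (m₀ - 1) * R a) (Set.Ioi 0) :=
    integrableOn_rpow_mul_tail_comp_mul hm₀ hγ0 hc hm_cont hbound
  have hi2 : IntegrableOn (fun a => a ^ m₀ * R a) (Set.Ioi 0) := by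
    simpa using integrableOn_rpow_mul_tail_comp_mul (s := m₀ + 1) (by linarith) hγ0 hc
      hm_cont hbound
  have he1 : ∫ a in Set.Ioi 0, a ^ (m₀ - 1) * R a = γ ^ (-m₀) * (Mhat m₀ / m₀) := by
    rw [hMhat _ hm₀]
    exact integral_rpow_mul_tail_comp_mul hm₀ hγ0 hc hm_cont hbound
  have he2 : ∫ a in Set.Ioi 0, a ^ m₀ * R a = γ ^ (-m₀ - 1) * D := by
    have h := integral_rpow_mul_tail_comp_mul (s := m₀ + 1) (by linarith) hγ0 hc hm_cont hbound
    rw [add_sub_cancel_right, ← hMhat _ (by linarith), neg_add'] at h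
    exact h
  set G : ℝ → ℝ := fun a => (f a - A * a ^ (m₀ - 1)) * R a with hG
  have hGle : ∀ a ∈ Set.Ioi (0 : ℝ), ‖G a‖ ≤ B * (a ^ m₀ * R a) := fun a ha => by
    have h := abs_gamma_mixture_sub_le hα hζ (s := m₀) (a := a) ha
    rw [← hf' a ha] at h
    rw [Real.norm_eq_abs, hG, abs_mul, abs_of_nonneg (hR0 a ha), ← mul_assoc]
    exact mul_le_mul_of_nonneg_right h (hR0 a ha)
  have hRcont : ContinuousOn R (Set.Ioi 0) := fun a ha => by
    have h := (hasDerivAt_tail hm_cont hint (mul_pos hγ0 ha)).continuousAt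
    exact (ContinuousAt.comp (f := fun a : ℝ => γ * a) h (by fun_prop)).continuousWithinAt
  have hGint : IntegrableOn G (Set.Ioi 0) := by
    refine Integrable.mono' (hi2.const_mul B) ?_ ?_
    · refine (hfint.aestronglyMeasurable.sub ?_).mul
        (hRcont.aestronglyMeasurable measurableSet_Ioi)
      refine ContinuousOn.aestronglyMeasurable ?_ measurableSet_Ioi
      exact continuousOn_const.mul
        (continuousOn_id.rpow_const fun x hx => Or.inl (ne_of_gt hx))
    · filter_upwards [ae_restrict_mem measurableSet_Ioi] with a ha using hGle a ha
  have hIbar' : Ibar γ = Iinf - ((∫ a in Set.Ioi 0, G a) + A * (γ ^ (-m₀) * (Mhat m₀ / m₀))) := by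
    rw [hIbar γ hγ0, ← he1, ← integral_const_mul, ← integral_add hGint (hi1.const_mul A)]
    have h1 : Iinf = ∫ a in Set.Ioi 0, f a * Iinf := by
      rw [integral_mul_const, hfone, one_mul]
    conv_rhs => rw [h1]
    refine Eq.trans ?_ (integral_sub (hfint.mul_const Iinf) (hGint.add (hi1.const_mul A)))
    refine setIntegral_congr_fun measurableSet_Ioi fun a ha => ?_
    have hγa := (mul_pos hγ0 ha).le
    have h2 : I (γ * a) = Iinf - R a := by
      rw [hI _ hγa, hIinf, hR]
      linarith [integral_Ioi_eq_sub hint hγa]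
    simp only [h2, hG]
    ring
  have hGabs : |∫ a in Set.Ioi 0, G a| ≤ B * (γ ^ (-m₀ - 1) * D) := by
    rw [← he2, ← integral_const_mul, ← Real.norm_eq_abs]
    refine norm_integral_le_of_norm_le (hi2.const_mul B) ?_
    filter_upwards [ae_restrict_mem measurableSet_Ioi] with a ha using hGle a ha
  rw [show Ibar γ - Iinf + A / m₀ * Mhat m₀ * γ ^ (-m₀) = -∫ a in Set.Ioi 0, G a by
    rw [hIbar']; ring, abs_neg]
  nlinarith [Real.rpow_pos_of_pos hγ0 (-m₀ - 1)]
end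

section
/- (η-μ fading.) Let μ > 0 and let h, H be reals with 0 < |H| < h. For l ≥ 1 set θ_l = 2√π μ^{2μ+2l−2} h^μ H^{2l−2} / (Γ(μ) Γ(l) Γ(μ+l−1/2)), T = h^μ 2^{2μ} μ^{2μ} / ((2μh)² − (2μH)²)^μ, α_l = θ_l / T, and define f(a) = Σ_{l=1}^∞ α_l a^{2(μ−1+l)−1} e^{−2μh a} for a > 0. Let m be an MMSE-type function with induced quantities I, I_∞, M̂. Then f is a probability density on (0,∞), and Ī(γ̄) = ∫_0^∞ f(a) I(γ̄ a) da satisfies, as γ̄ → ∞, Ī(γ̄) = I_∞ − (α_1/(2μ)) M̂(2μ) · γ̄^{−2μ} + O(γ̄^{−2μ−1}), where α_1 = 2√π μ^{2μ} (h² − H²)^μ / (Γ(μ) Γ(μ+1/2)); that is, the diversity order is 2μ and the coding gain is ((α_1/(2μ)) M̂(2μ))^{−1/(2μ)}. -/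
open MeasureTheory Real Filter Set

theorem Real.Gamma_add_natCast_eq_choose {a : ℝ} (ha : 0 < a) (n : ℕ) :
    Gamma (a + n) = Gamma a * n.factorial * Ring.choose (a + n - 1) n := by
  have h1 : Ring.choose (a + n - 1) n = Ring.multichoose a n := by
    rw [Ring.choose]; congr 1; ring
  have h2 := Ring.factorial_nsmul_multichoose_eq_ascPochhammer a n
  rw [Polynomial.ascPochhammer_smeval_eq_eval, nsmul_eq_mul] at h2
  rw [h1, mul_assoc, h2]
  clear h1 h2
  induction n with
  | zero => simp
  | succ k ih =>
    rw [ascPochhammer_succ_eval, ← mul_assoc, ← ih, Nat.cast_succ, ← add_assoc,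
      Gamma_add_one (by positivity), mul_comm]

theorem Real.hasSum_Gamma_div_mul_pow {a x : ℝ} (ha : 0 < a) (hx : |x| < 1) :
    HasSum (fun n : ℕ => Gamma (a + n) / (Gamma a * n.factorial) * x ^ n)
      (1 / (1 - x) ^ a) := by
  have h := (Real.one_div_one_sub_rpow_hasFPowerSeriesOnBall_zero a).hasSum (y := x)
    (by simpa [← ofReal_norm] using hx)
  rw [zero_add] at h
  refine h.congr_fun fun n => ?_
  have := (Gamma_pos_of_pos ha).ne'
  rw [Gamma_add_natCast_eq_choose ha, mul_assoc, mul_div_mul_left _ _ this,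
    mul_div_cancel_left₀ _ (by positivity)]
  simp [mul_comm]

theorem exists_le_mul_exp_neg {m : ℝ → ℝ} (hm_cont : ContinuousOn m (Ioi 0))
    (hm_lim : Tendsto m (nhdsWithin 0 (Ioi 0)) (nhds 1))
    (hm_decay : ∃ C > 0, ∃ c > 0, ∀ t ≥ 1, m t ≤ C * t ^ (-(1 : ℝ) / 2) * exp (-c * t)) :
    ∃ B > 0, ∃ c > 0, ∀ t > 0, m t ≤ B * exp (-c * t) := by
  obtain ⟨C, hC, c, hc, hdec⟩ := hm_decay
  have hev : ∀ᶠ t in nhdsWithin 0 (Ioi 0), m t < 2 := hm_lim.eventually_lt_const (by norm_num)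
  obtain ⟨δ, hδ, hlt⟩ := mem_nhdsGT_iff_exists_Ioo_subset.1 hev
  rw [mem_Ioi] at hδ
  obtain ⟨D, hD⟩ := (isCompact_Icc (a := δ) (b := 1)).bddAbove_image
    (hm_cont.mono fun t ht => hδ.trans_le ht.1)
  refine ⟨max 2 D * exp c + C, by positivity, c, hc, fun t ht => ?_⟩
  rcases le_total 1 t with h1 | h1
  · refine (hdec t h1).trans ?_
    gcongr
    have := rpow_le_one_of_one_le_of_nonpos h1 (by norm_num : -(1 : ℝ) / 2 ≤ 0)
    have : 0 ≤ max 2 D * exp c := by positivity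
    nlinarith
  · have hle : m t ≤ max 2 D := by
      rcases lt_or_ge t δ with h2 | h2
      · exact (hlt ⟨ht, h2⟩ : m t < 2).le.trans (le_max_left _ _)
      · exact (hD ⟨t, ⟨h2, h1⟩, rfl⟩).trans (le_max_right _ _)
    calc m t ≤ max 2 D * 1 := by simpa using hle
      _ ≤ max 2 D * exp (c + -c * t) := by
        gcongr
        exact one_le_exp (by nlinarith)
      _ = max 2 D * exp c * exp (-c * t) := by rw [exp_add, mul_assoc]
      _ ≤ _ := by gcongr; linarith

theorem integrableOn_rpow_mul_of_le_mul_exp_neg {m : ℝ → ℝ} (hm_cont : ContinuousOn m (Ioi 0))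
    (hm_pos : ∀ t > 0, 0 < m t) {B c : ℝ} (hc : 0 < c)
    (hm : ∀ t > 0, m t ≤ B * exp (-c * t)) {x : ℝ} (hx : -1 < x) :
    IntegrableOn (fun t => t ^ x * m t) (Ioi 0) := by
  have hg := (integrableOn_rpow_mul_exp_neg_mul_rpow hx one_pos hc).const_mul B
  refine hg.mono' ?_ ?_
  · refine ContinuousOn.aestronglyMeasurable ?_ measurableSet_Ioi
    exact (continuousOn_id.rpow_const fun t ht => Or.inl (ne_of_gt ht)).mul hm_cont
  · filter_upwards [ae_restrict_mem measurableSet_Ioi] with t ht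
    have h1 : 0 < t ^ x := rpow_pos_of_pos ht x
    rw [norm_of_nonneg (mul_pos h1 (hm_pos t ht)).le, rpow_one, mul_left_comm]
    exact mul_le_mul_of_nonneg_left (hm t ht) h1.le

theorem integral_mul_setIntegral_Ioc_eq {f m : ℝ → ℝ} (hf : IntegrableOn f (Ioi 0))
    (hm : IntegrableOn m (Ioi 0)) {γ : ℝ} (hγ : 0 < γ) :
    ∫ a in Ioi 0, f a * ∫ t in Ioc 0 (γ * a), m t =
      ∫ t in Ioi 0, m t * ∫ a in Ici (t / γ), f a := by
  have hmeas : MeasurableSet {z : ℝ × ℝ | z.2 ≤ γ * z.1} :=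
    measurableSet_le measurable_snd (measurable_fst.const_mul γ)
  have hint := (Integrable.mul_prod hf hm).indicator hmeas
  have hswap := integral_integral_swap
    (f := fun a t => {z : ℝ × ℝ | z.2 ≤ γ * z.1}.indicator (fun z => f z.1 * m z.2) (a, t)) hint
  calc ∫ a in Ioi 0, f a * ∫ t in Ioc 0 (γ * a), m t
      = ∫ a in Ioi 0, ∫ t in Ioi 0,
          {z : ℝ × ℝ | z.2 ≤ γ * z.1}.indicator (fun z => f z.1 * m z.2) (a, t) := by
        refine setIntegral_congr_fun measurableSet_Ioi fun a _ => ?_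
        have : ∀ t, {z : ℝ × ℝ | z.2 ≤ γ * z.1}.indicator (fun z => f z.1 * m z.2) (a, t) =
            (Iic (γ * a)).indicator (fun t => f a * m t) t := fun t => rfl
        simp only [this]
        rw [setIntegral_indicator measurableSet_Iic, Ioi_inter_Iic, integral_const_mul]
    _ = _ := hswap
    _ = ∫ t in Ioi 0, m t * ∫ a in Ici (t / γ), f a := by
        refine setIntegral_congr_fun measurableSet_Ioi fun t ht => ?_
        have h1 : ∀ a, {z : ℝ × ℝ | z.2 ≤ γ * z.1}.indicator (fun z => f z.1 * m z.2) (a, t) =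
            (Ici (t / γ)).indicator (fun a => m t * f a) a := fun a => by
          simp only [indicator_apply, mem_ofPred_eq, mem_Ici, div_le_iff₀ hγ, mul_comm]
        have h2 : Ioi 0 ∩ Ici (t / γ) = Ici (t / γ) :=
          inter_eq_right.2 fun a ha => (div_pos ht hγ).trans_le ha
        simp only [h1]
        rw [setIntegral_indicator measurableSet_Ici, h2, integral_const_mul]

theorem exists_abs_setIntegral_Ioo_sub_le {f : ℝ → ℝ} {p α K : ℝ} (hp : 0 < p) (hα : 0 ≤ α)
    (hK : 0 ≤ K) (hf : IntegrableOn f (Ioi 0)) (hf0 : ∀ a > 0, 0 ≤ f a)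
    (hf1 : ∫ a in Ioi 0, f a = 1)
    (hfK : ∀ a > 0, a ≤ 1 → |f a - α * a ^ (p - 1)| ≤ K * a ^ p) :
    ∃ L > 0, ∀ x > 0, |(∫ a in Ioo 0 x, f a) - α / p * x ^ p| ≤ L * x ^ (p + 1) := by
  refine ⟨K + 1 + α / p, by positivity, fun x hx => ?_⟩
  have hxp : 0 < x ^ (p + 1) := rpow_pos_of_pos hx _
  rcases le_total x 1 with h1 | h1
  · have hpow : ∀ q : ℝ, -1 < q → IntegrableOn (fun a : ℝ => a ^ q) (Ioo 0 x) := fun q hq =>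
      ((intervalIntegrable_iff_integrableOn_Ioc_of_le hx.le).1
        (intervalIntegral.intervalIntegrable_rpow' hq)).mono_set Ioo_subset_Ioc_self
    have hval : ∀ q : ℝ, -1 < q → ∫ a in Ioo 0 x, a ^ q = x ^ (q + 1) / (q + 1) := fun q hq => by
      rw [← integral_Ioc_eq_integral_Ioo, ← intervalIntegral.integral_of_le hx.le,
        integral_rpow (Or.inl hq), zero_rpow (by linarith), sub_zero]
    have e : (∫ a in Ioo 0 x, f a) - α / p * x ^ p =
        ∫ a in Ioo 0 x, (f a - α * a ^ (p - 1)) := by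
      rw [integral_sub (hf.mono_set Ioo_subset_Ioi_self) ((hpow _ (by linarith)).const_mul α),
        integral_const_mul, hval _ (by linarith), sub_add_cancel]
      ring
    rw [e, ← norm_eq_abs]
    calc ‖∫ a in Ioo 0 x, (f a - α * a ^ (p - 1))‖
        ≤ ∫ a in Ioo 0 x, K * a ^ p := by
          refine norm_integral_le_of_norm_le ((hpow p (by linarith)).const_mul K) ?_
          filter_upwards [ae_restrict_mem measurableSet_Ioo] with a ha
          exact hfK a ha.1 (ha.2.le.trans h1)
      _ = K / (p + 1) * x ^ (p + 1) := by
          rw [integral_const_mul, hval p (by linarith)]; ring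
      _ ≤ (K + 1 + α / p) * x ^ (p + 1) := by
          gcongr
          have : K / (p + 1) ≤ K := div_le_self hK (by linarith)
          have : 0 ≤ α / p := by positivity
          linarith
  · have hI0 : 0 ≤ ∫ a in Ioo 0 x, f a :=
      setIntegral_nonneg measurableSet_Ioo fun a ha => hf0 a ha.1
    have hI1 : ∫ a in Ioo 0 x, f a ≤ 1 := by
      rw [← hf1]
      refine setIntegral_mono_set hf ?_ (Eventually.of_forall Ioo_subset_Ioi_self)
      filter_upwards [ae_restrict_mem measurableSet_Ioi] with a ha using hf0 a ha
    have h2 : 1 ≤ x ^ (p + 1) := one_le_rpow h1 (by linarith)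
    have h3 : α / p * x ^ p ≤ α / p * x ^ (p + 1) := by
      gcongr
      linarith
    have h4 : 0 ≤ α / p * x ^ p := by positivity
    rw [abs_le]
    constructor <;> nlinarith

theorem exists_abs_integral_mul_setIntegral_sub_le {f m : ℝ → ℝ} {p α K : ℝ} (hp : 0 < p)
    (hα : 0 ≤ α) (hK : 0 ≤ K) (hf : IntegrableOn f (Ioi 0)) (hf0 : ∀ a > 0, 0 ≤ f a)
    (hf1 : ∫ a in Ioi 0, f a = 1)
    (hfK : ∀ a > 0, a ≤ 1 → |f a - α * a ^ (p - 1)| ≤ K * a ^ p)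
    (hm_pos : ∀ t > 0, 0 < m t)
    (hm : ∀ x : ℝ, -1 < x → IntegrableOn (fun t => t ^ x * m t) (Ioi 0)) :
    ∃ L > 0, ∀ γ > 0,
      |(∫ a in Ioi 0, f a * ∫ t in Ioc 0 (γ * a), m t) - (∫ t in Ioi 0, m t) +
        α / p * (∫ t in Ioi 0, t ^ p * m t) * γ ^ (-p)| ≤ L * γ ^ (-p - 1) := by
  obtain ⟨L, hL, hbd⟩ := exists_abs_setIntegral_Ioo_sub_le hp hα hK hf hf0 hf1 hfK
  have hm0 : IntegrableOn m (Ioi 0) := by simpa using hm 0 (by norm_num)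
  have hM0 : 0 ≤ ∫ t in Ioi 0, t ^ (p + 1) * m t :=
    setIntegral_nonneg measurableSet_Ioi fun t ht =>
      mul_nonneg (rpow_nonneg (le_of_lt ht) _) (hm_pos t ht).le
  refine ⟨L * (∫ t in Ioi 0, t ^ (p + 1) * m t) + 1, by positivity, fun γ hγ => ?_⟩
  have htail : ∀ t > 0, ∫ a in Ici (t / γ), f a = 1 - ∫ a in Ioo 0 (t / γ), f a := fun t ht => by
    rw [← hf1, ← Ioo_union_Ici_eq_Ioi (div_pos ht hγ), setIntegral_union]
    · ring
    · exact disjoint_left.2 fun a ha hb => not_lt.2 hb ha.2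
    · exact measurableSet_Ici
    · exact hf.mono_set Ioo_subset_Ioi_self
    · exact hf.mono_set fun a ha => (div_pos ht hγ).trans_le ha
  have hdiv : ∀ t > 0, ∀ q : ℝ, (t / γ) ^ q = t ^ q * γ ^ (-q) := fun t ht q => by
    rw [div_rpow (le_of_lt ht) hγ.le, rpow_neg hγ.le, div_eq_mul_inv]
  have hbound : ∀ t > 0, |(m t * ∫ a in Ici (t / γ), f a) - m t + α / p * γ ^ (-p) * (t ^ p * m t)|
      ≤ L * γ ^ (-p - 1) * (t ^ (p + 1) * m t) := fun t ht => by
    have h := hbd (t / γ) (div_pos ht hγ)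
    rw [hdiv t ht, hdiv t ht, neg_add'] at h
    rw [htail t ht]
    calc _ = m t * |(∫ a in Ioo 0 (t / γ), f a) - α / p * (t ^ p * γ ^ (-p))| := by
          rw [← abs_of_pos (hm_pos t ht), ← abs_mul, ← abs_neg, abs_of_pos (hm_pos t ht)]
          ring_nf
      _ ≤ m t * (L * (t ^ (p + 1) * γ ^ (-p - 1))) :=
          mul_le_mul_of_nonneg_left h (hm_pos t ht).le
      _ = _ := by ring
  have hint : IntegrableOn (fun t => m t * ∫ a in Ici (t / γ), f a) (Ioi 0) := by
    refine hm0.mono' (hm0.1.mul ?_) ?_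
    · refine (aemeasurable_restrict_of_antitoneOn measurableSet_Ioi
        fun s hs t ht hst => ?_).aestronglyMeasurable
      have hsub : Ici (s / γ) ⊆ Ioi 0 := fun a ha => (div_pos hs hγ).trans_le ha
      refine setIntegral_mono_set (hf.mono_set hsub) ?_ (Eventually.of_forall (Ici_subset_Ici.2 ?_))
      · filter_upwards [ae_restrict_mem measurableSet_Ici] with a ha using hf0 a (hsub ha)
      · gcongr
    · filter_upwards [ae_restrict_mem measurableSet_Ioi] with t ht
      have hsub : Ici (t / γ) ⊆ Ioi 0 := fun a ha => (div_pos ht hγ).trans_le ha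
      have h0 : 0 ≤ ∫ a in Ici (t / γ), f a :=
        setIntegral_nonneg measurableSet_Ici fun a ha => hf0 a (hsub ha)
      have h1 : 0 ≤ ∫ a in Ioo 0 (t / γ), f a :=
        setIntegral_nonneg measurableSet_Ioo fun a ha => hf0 a ha.1
      rw [norm_of_nonneg (mul_nonneg (hm_pos t ht).le h0)]
      exact mul_le_of_le_one_right (hm_pos t ht).le (by linarith [htail t ht])
  rw [integral_mul_setIntegral_Ioc_eq hf hm0 hγ]
  have hp' := (hm p (by linarith)).const_mul (α / p * γ ^ (-p))
  have e : (∫ t in Ioi 0, m t * ∫ a in Ici (t / γ), f a) - (∫ t in Ioi 0, m t) +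
        α / p * (∫ t in Ioi 0, t ^ p * m t) * γ ^ (-p) =
      ∫ t in Ioi 0, ((m t * ∫ a in Ici (t / γ), f a) - m t +
        α / p * γ ^ (-p) * (t ^ p * m t)) := by
    rw [integral_add (f := fun t => (m t * ∫ a in Ici (t / γ), f a) - m t) (hint.sub hm0) hp',
      integral_sub hint hm0, integral_const_mul]
    ring
  rw [e, ← norm_eq_abs]
  calc _ ≤ ∫ t in Ioi 0, L * γ ^ (-p - 1) * (t ^ (p + 1) * m t) := by
        refine norm_integral_le_of_norm_le ((hm (p + 1) (by linarith)).const_mul _) ?_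
        filter_upwards [ae_restrict_mem measurableSet_Ioi] with t ht using hbound t ht
    _ = L * (∫ t in Ioi 0, t ^ (p + 1) * m t) * γ ^ (-p - 1) := by
        rw [integral_const_mul]; ring
    _ ≤ _ := by
        gcongr
        linarith

theorem Real.pow_mul_Gamma_le_Gamma_add_natCast {s : ℝ} (hs : 0 < s) (n : ℕ) :
    s ^ n * Gamma s ≤ Gamma (s + n) := by
  induction n with
  | zero => simp
  | succ k ih =>
    rw [Nat.cast_succ, ← add_assoc, Gamma_add_one (by positivity), pow_succ', mul_assoc]
    have := Gamma_pos_of_pos hs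
    gcongr
    simp

/-- The coefficients of the η-μ density as a combination of the functions
`a ^ (2 * (μ + n) - 1) * exp (-(2 * μ * h) * a)`. -/
noncomputable def etaMuCoeff (μ h H : ℝ) (n : ℕ) : ℝ :=
  2 * √π * μ ^ (2 * μ + 2 * (n : ℝ)) * (h ^ 2 - H ^ 2) ^ μ * H ^ (2 * n) /
    (Gamma μ * n.factorial * Gamma (μ + n + 1 / 2))

section EtaMu

variable {μ h H : ℝ}

theorem sq_sub_sq_pos_of_abs_lt (hHh : |H| < h) : 0 < h ^ 2 - H ^ 2 :=
  sub_pos.2 (sq_lt_sq.2 (hHh.trans_le (le_abs_self h)))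

theorem etaMuCoeff_nonneg (hμ : 0 < μ) (hHh : |H| < h) (n : ℕ) : 0 ≤ etaMuCoeff μ h H n := by
  have := sq_sub_sq_pos_of_abs_lt hHh
  have := Gamma_pos_of_pos hμ
  have : 0 < Gamma (μ + n + 1 / 2) := Gamma_pos_of_pos (by positivity)
  have := (even_two_mul n).pow_nonneg H
  unfold etaMuCoeff
  positivity

theorem div_eq_etaMuCoeff (hμ : 0 < μ) (hHh : |H| < h) (n : ℕ) :
    2 * √π * μ ^ (2 * μ + 2 * (n : ℝ)) * h ^ μ * H ^ (2 * n) /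
        (Gamma μ * Gamma ((n : ℝ) + 1) * Gamma (μ + (n : ℝ) + 1 / 2)) /
      (h ^ μ * 2 ^ (2 * μ) * μ ^ (2 * μ) / ((2 * μ * h) ^ 2 - (2 * μ * H) ^ 2) ^ μ) =
    etaMuCoeff μ h H n := by
  have hD := sq_sub_sq_pos_of_abs_lt hHh
  have hh : 0 < h := (abs_nonneg H).trans_lt hHh
  have hΓ := Gamma_pos_of_pos hμ
  have : 0 < Gamma (μ + n + 1 / 2) := Gamma_pos_of_pos (by positivity)
  have e : ((2 * μ * h) ^ 2 - (2 * μ * H) ^ 2) ^ μ =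
      2 ^ (2 * μ) * μ ^ (2 * μ) * (h ^ 2 - H ^ 2) ^ μ := by
    rw [show (2 * μ * h) ^ 2 - (2 * μ * H) ^ 2 = 2 ^ 2 * μ ^ 2 * (h ^ 2 - H ^ 2) by ring,
      mul_rpow (by positivity) hD.le, mul_rpow (by positivity) (by positivity),
      rpow_mul zero_le_two, rpow_mul hμ.le, rpow_two, rpow_two]
  have h1 : (0 : ℝ) < 2 ^ (2 * μ) := by positivity
  have h2 : 0 < μ ^ (2 * μ) := by positivity
  have h3 : 0 < (h ^ 2 - H ^ 2) ^ μ := by positivity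
  have h4 : 0 < h ^ μ := by positivity
  rw [e, Gamma_nat_eq_factorial, etaMuCoeff]
  field_simp

theorem summable_etaMuCoeff (hμ : 0 < μ) (hHh : |H| < h) : Summable (etaMuCoeff μ h H) := by
  have hD := sq_sub_sq_pos_of_abs_lt hHh
  have hΓ := Gamma_pos_of_pos hμ
  have hs : 0 < μ + 1 / 2 := by positivity
  have hΓs := Gamma_pos_of_pos hs
  refine Summable.of_nonneg_of_le (etaMuCoeff_nonneg hμ hHh) (fun n => ?_)
    ((summable_pow_div_factorial (μ ^ 2 * H ^ 2 / (μ + 1 / 2))).mul_left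
      (2 * √π * μ ^ (2 * μ) * (h ^ 2 - H ^ 2) ^ μ / (Gamma μ * Gamma (μ + 1 / 2))))
  have hle := pow_mul_Gamma_le_Gamma_add_natCast hs n
  rw [add_right_comm] at hle
  have hH := (even_two_mul n).pow_nonneg H
  calc etaMuCoeff μ h H n
      ≤ 2 * √π * μ ^ (2 * μ + 2 * (n : ℝ)) * (h ^ 2 - H ^ 2) ^ μ * H ^ (2 * n) /
        (Gamma μ * n.factorial * ((μ + 1 / 2) ^ n * Gamma (μ + 1 / 2))) := by
        unfold etaMuCoeff
        gcongr
    _ = _ := by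
        rw [rpow_add hμ, ← Nat.cast_ofNat, ← Nat.cast_mul, rpow_natCast, Nat.cast_ofNat, div_pow,
          mul_pow, ← pow_mul, ← pow_mul]
        field_simp

theorem integral_etaMuCoeff_mul (hμ : 0 < μ) (hHh : |H| < h) (n : ℕ) :
    ∫ a in Ioi 0, etaMuCoeff μ h H n * a ^ (2 * (μ + (n : ℝ)) - 1) * exp (-(2 * μ * h) * a) =
      (1 - (H / h) ^ 2) ^ μ * (Gamma (μ + n) / (Gamma μ * n.factorial) * ((H / h) ^ 2) ^ n) := by
  have hD := sq_sub_sq_pos_of_abs_lt hHh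
  have hh : 0 < h := (abs_nonneg H).trans_lt hHh
  have hΓ := Gamma_pos_of_pos hμ
  have hs : 0 < μ + n := by positivity
  have hΓs := Gamma_pos_of_pos (show 0 < μ + n + 1 / 2 by positivity)
  have hdup := Gamma_mul_Gamma_add_half_of_pos hs
  have hx : (1 - (H / h) ^ 2) = (h ^ 2 - H ^ 2) / h ^ 2 := by field_simp
  have hpow : h ^ (2 * (μ + (n : ℝ))) = h ^ (2 * μ) * h ^ (2 * n) := by
    rw [mul_add, rpow_add hh, ← rpow_natCast h (2 * n)]; push_cast; rfl
  have hdup' : Gamma (2 * (μ + n)) =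
      Gamma (μ + n) * Gamma (μ + n + 1 / 2) * 2 ^ (2 * (μ + (n : ℝ))) / (2 * √π) := by
    rw [hdup, rpow_sub two_pos, rpow_one]
    field_simp
  simp only [mul_assoc, integral_const_mul]
  have hint := integral_rpow_mul_exp_neg_mul_Ioi (mul_pos two_pos hs)
    (show 0 < 2 * (μ * h) by positivity)
  simp only [← neg_mul] at hint
  simp only [← neg_mul]
  rw [hint, hdup', etaMuCoeff, hx, div_rpow hD.le (by positivity), one_div (2 * (μ * h)),
    inv_rpow (by positivity),
    mul_rpow zero_le_two (by positivity), mul_rpow hμ.le hh.le, ← mul_add 2 μ, hpow,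
    div_pow, div_pow, ← rpow_two h, ← rpow_mul hh.le, rpow_two, ← pow_mul, ← pow_mul]
  have : μ ^ (2 * (μ + (n : ℝ))) ≠ 0 := by positivity
  have : (2 : ℝ) ^ (2 * (μ + (n : ℝ))) ≠ 0 := by positivity
  have : h ^ (2 * μ) ≠ 0 := by positivity
  field_simp

theorem integral_tsum_etaMuCoeff (hμ : 0 < μ) (hHh : |H| < h) :
    ∫ a in Ioi 0, ∑' n : ℕ,
      etaMuCoeff μ h H n * a ^ (2 * (μ + (n : ℝ)) - 1) * exp (-(2 * μ * h) * a) = 1 := by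
  have hD := sq_sub_sq_pos_of_abs_lt hHh
  have hh : 0 < h := (abs_nonneg H).trans_lt hHh
  have hx1 : (H / h) ^ 2 < 1 := by
    rw [div_pow, div_lt_one (by positivity)]; linarith
  have hx : |(H / h) ^ 2| < 1 := by rwa [abs_of_nonneg (sq_nonneg _)]
  have hsum := (hasSum_Gamma_div_mul_pow hμ hx).mul_left ((1 - (H / h) ^ 2) ^ μ)
  have hne : (1 - (H / h) ^ 2) ^ μ ≠ 0 := (rpow_pos_of_pos (by linarith) _).ne'
  rw [mul_one_div_cancel hne] at hsum
  have hnorm : ∀ n : ℕ,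
      ∫ a in Ioi 0, ‖etaMuCoeff μ h H n * a ^ (2 * (μ + (n : ℝ)) - 1) * exp (-(2 * μ * h) * a)‖ =
      ∫ a in Ioi 0, etaMuCoeff μ h H n * a ^ (2 * (μ + (n : ℝ)) - 1) * exp (-(2 * μ * h) * a) :=
    fun n => setIntegral_congr_fun measurableSet_Ioi fun a ha => norm_of_nonneg
      (mul_nonneg (mul_nonneg (etaMuCoeff_nonneg hμ hHh n) (rpow_nonneg (le_of_lt ha) _))
        (exp_pos _).le)
  have h1 := hasSum_integral_of_summable_integral_norm (μ := volume.restrict (Ioi 0))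
    (F := fun (n : ℕ) a =>
      etaMuCoeff μ h H n * a ^ (2 * (μ + (n : ℝ)) - 1) * exp (-(2 * μ * h) * a))
    (fun n => by
      have := (integrableOn_rpow_mul_exp_neg_mul_rpow (p := 1) (b := 2 * μ * h)
        (s := 2 * (μ + (n : ℝ)) - 1) (by linarith [(Nat.cast_nonneg n : (0 : ℝ) ≤ n)])
        one_pos (by positivity)).const_mul (etaMuCoeff μ h H n)
      simpa only [rpow_one, mul_assoc] using this)
    (by simpa only [hnorm, integral_etaMuCoeff_mul hμ hHh] using hsum.summable)
  simp only [integral_etaMuCoeff_mul hμ hHh] at h1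
  exact h1.unique hsum

theorem exists_abs_tsum_etaMuCoeff_sub_le (hμ : 0 < μ) (hHh : |H| < h) :
    ∃ K ≥ 0, ∀ a > 0, a ≤ 1 →
      |(∑' n : ℕ, etaMuCoeff μ h H n * a ^ (2 * (μ + (n : ℝ)) - 1) * exp (-(2 * μ * h) * a)) -
        etaMuCoeff μ h H 0 * a ^ (2 * μ - 1)| ≤ K * a ^ (2 * μ) := by
  have hh : 0 < h := (abs_nonneg H).trans_lt hHh
  have hα := etaMuCoeff_nonneg hμ hHh
  have hS := (summable_nat_add_iff 1).2 (summable_etaMuCoeff hμ hHh)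
  have hS0 : 0 ≤ ∑' n, etaMuCoeff μ h H (n + 1) := tsum_nonneg fun n => hα _
  have h0 := hα 0
  refine ⟨(∑' n, etaMuCoeff μ h H (n + 1)) + etaMuCoeff μ h H 0 * (2 * μ * h), by positivity,
    fun a ha ha1 => ?_⟩
  set F : ℕ → ℝ := fun n =>
    etaMuCoeff μ h H n * a ^ (2 * (μ + (n : ℝ)) - 1) * exp (-(2 * μ * h) * a) with hF
  have hexp : exp (-(2 * μ * h) * a) ≤ 1 := exp_le_one_iff.2 (by nlinarith [mul_pos hμ hh])
  have hF0 : ∀ n, 0 ≤ F n := fun n => mul_nonneg (mul_nonneg (hα n) (by positivity)) (exp_pos _).le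
  have hFle : ∀ n, F (n + 1) ≤ etaMuCoeff μ h H (n + 1) * a ^ (2 * μ) := fun n => by
    refine (mul_le_of_le_one_right (mul_nonneg (hα _) (by positivity)) hexp).trans ?_
    refine mul_le_mul_of_nonneg_left (rpow_le_rpow_of_exponent_ge ha ha1 ?_) (hα _)
    push_cast
    linarith [(Nat.cast_nonneg n : (0 : ℝ) ≤ n)]
  have hFs : Summable fun n => F (n + 1) :=
    Summable.of_nonneg_of_le (fun n => hF0 _) hFle (hS.mul_right _)
  have htail : ∑' n, F (n + 1) ≤ (∑' n, etaMuCoeff μ h H (n + 1)) * a ^ (2 * μ) := by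
    rw [← tsum_mul_right]
    exact hFs.tsum_le_tsum hFle (hS.mul_right _)
  have htail0 : 0 ≤ ∑' n, F (n + 1) := tsum_nonneg fun n => hF0 _
  have hsplit : ∑' n, F n = F 0 + ∑' n, F (n + 1) :=
    ((summable_nat_add_iff 1).1 hFs).tsum_eq_zero_add
  have hFz : F 0 = etaMuCoeff μ h H 0 * a ^ (2 * μ - 1) * exp (-(2 * μ * h) * a) := by simp [hF]
  have hP : 0 ≤ etaMuCoeff μ h H 0 * a ^ (2 * μ - 1) := by positivity
  have hupper : F 0 ≤ etaMuCoeff μ h H 0 * a ^ (2 * μ - 1) :=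
    hFz.trans_le (mul_le_of_le_one_right hP hexp)
  have hlower : etaMuCoeff μ h H 0 * a ^ (2 * μ - 1) -
      etaMuCoeff μ h H 0 * (2 * μ * h) * a ^ (2 * μ) ≤ F 0 := by
    have hpow : a ^ (2 * μ) = a ^ (2 * μ - 1) * a := by
      rw [← rpow_add_one ha.ne', sub_add_cancel]
    rw [hFz, hpow]
    nlinarith [mul_le_mul_of_nonneg_left (add_one_le_exp (-(2 * μ * h) * a)) hP]
  have : 0 ≤ etaMuCoeff μ h H 0 * (2 * μ * h) * a ^ (2 * μ) := by positivity
  have : 0 ≤ (∑' n, etaMuCoeff μ h H (n + 1)) * a ^ (2 * μ) := by positivity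
  rw [hsplit, abs_le]
  constructor <;> linarith

end EtaMu

/-- **η-μ fading.** For the η-μ density, written as an infinite gamma mixture
(indexing: the paper's `l ≥ 1` corresponds to `n = l - 1 : ℕ` below), the AMI satisfies
`Ī(γ̄) = I_∞ − (α₁/(2μ)) M̂(2μ) γ̄^{−2μ} + O(γ̄^{−2μ−1})` as `γ̄ → ∞`, where
`α₁ = 2√π μ^{2μ} (h² − H²)^μ / (Γ(μ) Γ(μ+1/2))`; moreover `f` is a probability density
on `(0,∞)`. -/
theorem asymptotic_AMI_eta_mu
    (μ h H : ℝ) (hμ : 0 < μ) (hH : 0 < |H|) (hHh : |H| < h)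
    (θ : ℕ → ℝ)
    (hθ : ∀ n : ℕ, θ n =
      2 * Real.sqrt Real.pi * μ ^ (2 * μ + 2 * (n : ℝ)) * h ^ μ * H ^ (2 * n) /
        (Real.Gamma μ * Real.Gamma ((n : ℝ) + 1) * Real.Gamma (μ + (n : ℝ) + 1 / 2)))
    (T : ℝ)
    (hT : T = h ^ μ * 2 ^ (2 * μ) * μ ^ (2 * μ) /
      ((2 * μ * h) ^ 2 - (2 * μ * H) ^ 2) ^ μ)
    (f : ℝ → ℝ)
    (hf : ∀ a > 0, f a =
      ∑' n : ℕ, (θ n / T) * a ^ (2 * (μ + (n : ℝ)) - 1) * Real.exp (-(2 * μ * h) * a))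
    (m : ℝ → ℝ)
    (hm_cont : ContinuousOn m (Set.Ioi 0))
    (hm_pos : ∀ t > 0, 0 < m t)
    (hm_lim : Tendsto m (nhdsWithin 0 (Set.Ioi 0)) (nhds 1))
    (hm_decay : ∃ C > 0, ∃ c > 0, ∀ t ≥ 1, m t ≤ C * t ^ (-(1 : ℝ) / 2) * Real.exp (-c * t))
    (I : ℝ → ℝ) (hI : ∀ γ ≥ 0, I γ = ∫ t in Set.Ioc 0 γ, m t)
    (Iinf : ℝ) (hIinf : Iinf = ∫ t in Set.Ioi 0, m t)
    (Mhat : ℝ → ℝ) (hMhat : ∀ x > 0, Mhat x = ∫ t in Set.Ioi 0, t ^ x * m t)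
    (Ibar : ℝ → ℝ) (hIbar : ∀ γ > 0, Ibar γ = ∫ a in Set.Ioi 0, f a * I (γ * a))
    (α₁ : ℝ)
    (hα₁ : α₁ = 2 * Real.sqrt Real.pi * μ ^ (2 * μ) * (h ^ 2 - H ^ 2) ^ μ /
      (Real.Gamma μ * Real.Gamma (μ + 1 / 2))) :
    -- `f` is a probability density on `(0,∞)`:
    (∀ a > 0, 0 ≤ f a) ∧ (∫ a in Set.Ioi 0, f a) = 1 ∧
    -- asymptotic expansion (diversity order `2μ`, coding gain `((α₁/(2μ)) M̂(2μ))^{−1/(2μ)}`):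
    ∃ C' > 0, ∃ γ0 > 0, ∀ γ ≥ γ0,
      |Ibar γ - Iinf + (α₁ / (2 * μ)) * Mhat (2 * μ) * γ ^ (-(2 * μ))|
        ≤ C' * γ ^ (-(2 * μ) - 1) := by
  have hcoeff : ∀ n, θ n / T = etaMuCoeff μ h H n := fun n => by
    rw [hθ, hT, div_eq_etaMuCoeff hμ hHh]
  have hα : α₁ = etaMuCoeff μ h H 0 := by simp [hα₁, etaMuCoeff]
  simp only [hcoeff] at hf
  have hf0 : ∀ a > 0, 0 ≤ f a := fun a ha => by
    rw [hf a ha]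
    exact tsum_nonneg fun n =>
      mul_nonneg (mul_nonneg (etaMuCoeff_nonneg hμ hHh n) (by positivity)) (exp_pos _).le
  have hf1 : ∫ a in Ioi 0, f a = 1 := by
    rw [← integral_tsum_etaMuCoeff hμ hHh]
    exact setIntegral_congr_fun measurableSet_Ioi hf
  have hfint : IntegrableOn f (Ioi 0) := by
    by_contra hcon
    exact zero_ne_one ((integral_undef hcon).symm.trans hf1)
  obtain ⟨K, hK, hbound⟩ := exists_abs_tsum_etaMuCoeff_sub_le hμ hHh
  obtain ⟨B, -, c, hc, hm⟩ := exists_le_mul_exp_neg hm_cont hm_lim hm_decay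
  obtain ⟨L, hL, hLbound⟩ := exists_abs_integral_mul_setIntegral_sub_le (mul_pos two_pos hμ)
    (etaMuCoeff_nonneg hμ hHh 0) hK hfint hf0 hf1
    (fun a ha ha1 => by simpa only [hf a ha] using hbound a ha ha1) hm_pos
    (fun x hx => integrableOn_rpow_mul_of_le_mul_exp_neg hm_cont hm_pos hc hm hx)
  refine ⟨hf0, hf1, L, hL, 1, one_pos, fun γ hγ => ?_⟩
  have hγ0 : 0 < γ := one_pos.trans_le hγ
  have hI' : Ibar γ = ∫ a in Ioi 0, f a * ∫ t in Ioc 0 (γ * a), m t := by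
    rw [hIbar γ hγ0]
    exact setIntegral_congr_fun measurableSet_Ioi fun a ha => by
      simp only [hI (γ * a) (mul_pos hγ0 ha).le]
  rw [hI', hIinf, hMhat _ (mul_pos two_pos hμ), hα]
  exact hLbound γ hγ0
end
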